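/- If f ∈ cl(CP) has positive topological entropy, then f² is turbulent; consequently h_top(f) ≥ (log 2)/2 and f has a periodic point of period 6. In particular, every f ∈ cl(CP) satisfies either h_top(f) = 0 or h_top(f) ≥ (log 2)/2. -/

import Mathlib

open Set Function Metric Dynamics

/-- The unit interval `[0,1]` with the Euclidean metric. -/
abbrev unitI : Type := Set.Icc (0:ℝ) 1

/-- `CP`: continuous surjective self-maps of `I` with a dense set of periodic points.
The ambient space `C(I,I)` carries the uniform (sup) metric. -/
def CP : Set C(unitI, unitI) :=
  {f | Function.Surjective ⇑f ∧ Dense (Function.periodicPts ⇑f)}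

/-- Topological entropy of a self-map of `I` (cover entropy with respect to the
natural uniformity on `I`). -/
noncomputable def hTop (f : unitI → unitI) : EReal :=
  Dynamics.coverEntropy f Set.univ

/-- A map `f : I → I` is turbulent if there are nondegenerate closed intervals
`J = [a,b]` and `K = [c,d]` with at most one point in common such that
`J ∪ K ⊆ f(J) ∩ f(K)`. -/
def Turbulent (f : unitI → unitI) : Prop :=
  ∃ a b c d : unitI, a < b ∧ c < d ∧ (Set.Icc a b ∩ Set.Icc c d).Subsingleton ∧
    Set.Icc a b ∪ Set.Icc c d ⊆ (f '' Set.Icc a b) ∩ (f '' Set.Icc c d)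


/-- `g` has no proper trapping region: a nonempty closed set mapped into its own interior is
the whole space. -/
def TrapFree {α : Type*} [TopologicalSpace α] (g : α → α) : Prop :=
  ∀ K : Set α, IsClosed K → K.Nonempty → MapsTo g K (interior K) → K = univ

/-- A fixed point `a`, a preimage `y` of `a` and a preimage `c` of `y` lying strictly
between `a` and `y`. -/
def HasFold {α : Type*} [Preorder α] (g : α → α) : Prop :=
  ∃ a c y : α, (a < c ∧ c < y ∨ y < c ∧ c < a) ∧ g a = a ∧ g c = y ∧ g y = a

theorem HasFold.ofDual {α : Type*} [Preorder α] {g : α → α}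
    (h : HasFold (α := αᵒᵈ) g) : HasFold g := by
  obtain ⟨a, c, y, h, h'⟩ := h
  exact ⟨a, c, y, h.symm.imp And.symm And.symm, h'⟩

section Order

variable {α : Type*} [ConditionallyCompleteLinearOrder α] [TopologicalSpace α] [OrderTopology α]
  [DenselyOrdered α] {g : α → α}

/-- If every point to the left of the fixed point `p` moves to the right, then `p` has a one-sided
neighbourhood `[l, p]` whose points stay below a given `q > p` and well above `l`. -/
theorem exists_left_barrier (hg : Continuous g) {p q : α} (hp : g p = p) (hpq : p < q)
    (h : ∀ t < p, t < g t) :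
    ∃ l ≤ p, (∀ t, p ≤ t → Ici l ∈ nhds t) ∧ (∀ t ∈ Icc l p, Ici l ∈ nhds (g t) ∧ g t < q) ∧
      (Ici l = univ → Ici p = univ) := by
  by_cases hbot : ∃ b, b < p
  · obtain ⟨b, hb⟩ := hbot
    obtain ⟨l', hl', hl'sub⟩ := exists_Ioc_subset_of_mem_nhds
      ((isOpen_Iio.preimage hg).mem_nhds (show p ∈ g ⁻¹' Iio q by simpa [hp])) ⟨b, hb⟩
    obtain ⟨l, hl'l, hl⟩ := exists_between hl'
    refine ⟨l, hl.le, fun t ht => Ici_mem_nhds (hl.trans_le ht), fun t ht => ⟨?_, ?_⟩, fun hu => ?_⟩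
    · rcases ht.2.lt_or_eq with htp | rfl
      · exact Ici_mem_nhds (ht.1.trans_lt (h t htp))
      · exact Ici_mem_nhds (hl.trans_eq hp.symm)
    · exact hl'sub ⟨hl'l.trans_le ht.1, ht.2⟩
    · exact absurd (hu ▸ mem_univ l' : l' ∈ Ici l) hl'l.not_ge
  · push Not at hbot
    have hu : Ici p = univ := eq_univ_of_forall hbot
    refine ⟨p, le_rfl, fun t _ => by simp [hu], fun t ht => ⟨by simp [hu], ?_⟩, id⟩
    rwa [le_antisymm ht.2 ht.1, hp]

variable [CompactSpace α]

/-- In a trap-free system, a point pushed away to the right of a fixed point creates a fold. -/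
theorem TrapFree.hasFold_of_lt (hT : TrapFree g) (hg : Continuous g) {p x : α} (hpx : p < x)
    (hp : g p = p) (hx : x < g x) : HasFold g := by
  obtain ⟨a, ⟨hax', hga'⟩, ha_max⟩ : ∃ a, IsGreatest {t | t ≤ x ∧ g t ≤ t} a :=
    (isClosed_Iic.inter (isClosed_le hg continuous_id)).isCompact.exists_isGreatest
      ⟨p, hpx.le, hp.le⟩
  have hax : a < x := hax'.lt_of_ne (by rintro rfl; exact absurd hga' hx.not_ge)
  have hlt : ∀ t, a < t → t ≤ x → t < g t := fun t hat htx =>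
    lt_of_not_ge fun h => (ha_max ⟨htx, h⟩).not_gt hat
  have hga : g a = a := by
    obtain ⟨t, ht, hgt⟩ := isPreconnected_Icc.intermediate_value₂ (s := Icc a x)
      (left_mem_Icc.2 hax') (right_mem_Icc.2 hax') hg.continuousOn continuousOn_id hga' hx.le
    rwa [← le_antisymm ht.1 (ha_max ⟨ht.2, hgt.le⟩)] at hgt
  -- Points to the right of `x` must return to `a`, otherwise some `Ici e` is a trap.
  have hret : ∃ y, x ≤ y ∧ g y ≤ a := by
    obtain ⟨y, hxy, hy⟩ := (isClosed_Ici (a := x)).isCompact.exists_isMinOn ⟨x, self_mem_Ici⟩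
      hg.continuousOn
    refine ⟨y, hxy, le_of_not_gt fun h => ?_⟩
    obtain ⟨e, hae, he⟩ := exists_between (lt_min h hax)
    have : Ici e = univ := hT _ isClosed_Ici ⟨e, self_mem_Ici⟩ fun t het => by
      refine interior_maximal Ioi_subset_Ici_self isOpen_Ioi ?_
      rcases le_total t x with htx | hxt
      · exact lt_of_le_of_lt het (hlt t (hae.trans_le het) htx)
      · exact (he.trans_le (min_le_left _ _)).trans_le (hy hxt)
    exact absurd (this ▸ mem_univ a : a ∈ Ici e) hae.not_ge
  obtain ⟨y, ⟨hxy, hgy'⟩, hy_min⟩ : ∃ y, IsLeast {t | x ≤ t ∧ g t ≤ a} y :=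
    (isClosed_Ici.inter (isClosed_le hg continuous_const)).isCompact.exists_isLeast hret
  have hgy : g y = a := by
    obtain ⟨t, ht, hgt⟩ := intermediate_value_Icc' hxy hg.continuousOn
      ⟨hgy', (hax.trans hx).le⟩
    rwa [← le_antisymm (hy_min ⟨ht.1, hgt.le⟩) ht.2] at hgt
  have hay : a < y := hax.trans_le hxy
  by_cases hz : ∃ z ∈ Icc a y, y ≤ g z
  · obtain ⟨z, hz, hgz⟩ := hz
    obtain ⟨c, hc, hgc⟩ := intermediate_value_Icc hz.1 hg.continuousOn
      ⟨hga.trans_le hay.le, hgz⟩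
    refine ⟨a, c, y, .inl ⟨hc.1.lt_of_ne ?_, (hc.2.trans hz.2).lt_of_ne ?_⟩, hga, hgc, hgy⟩
    · rintro rfl; exact hay.ne (hga.symm.trans hgc)
    · rintro rfl; exact hay.ne (hgy.symm.trans hgc)
  push Not at hz
  -- The interval `[a, y]` is mapped into `[a, y)`, which leaves room for a trap inside.
  obtain ⟨M, hM, hMmax⟩ := isCompact_Icc.exists_isMaxOn ⟨a, left_mem_Icc.2 hay.le⟩
    (hg.continuousOn (s := Icc a y))
  obtain ⟨m, hMm, hmy⟩ := exists_between (hz M hM)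
  have hxm : x < m := hx.trans ((hMmax ⟨hax', hxy⟩).trans_lt hMm)
  obtain ⟨w, hw, hwmin⟩ := isCompact_Icc.exists_isMinOn ⟨x, left_mem_Icc.2 hxm.le⟩
    (hg.continuousOn (s := Icc x m))
  have haw : a < g w := lt_of_not_ge fun h => (hy_min ⟨hw.1, h⟩).not_gt (hw.2.trans_lt hmy)
  obtain ⟨e, hae, he⟩ := exists_between (lt_min haw hax)
  have : Icc e m = univ := hT _ isClosed_Icc
      ⟨m, (he.le.trans (min_le_right _ _)).trans hxm.le, le_rfl⟩ fun t ht => by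
    refine interior_maximal Ioo_subset_Icc_self isOpen_Ioo ⟨?_, ?_⟩
    · rcases le_total t x with htx | hxt
      · exact lt_of_le_of_lt ht.1 (hlt t (hae.trans_le ht.1) htx)
      · exact (he.trans_le (min_le_left _ _)).trans_le (hwmin ⟨hxt, ht.2⟩)
    · exact lt_of_le_of_lt (hMmax ⟨hae.le.trans ht.1, ht.2.trans hmy.le⟩) hMm
  exact absurd (this ▸ mem_univ a : a ∈ Icc e m).1 hae.not_ge

theorem TrapFree.hasFold_of_gt (hT : TrapFree g) (hg : Continuous g) {p x : α} (hpx : x < p)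
    (hp : g p = p) (hx : g x < x) : HasFold g :=
  have : CompactSpace αᵒᵈ := ‹CompactSpace α›
  HasFold.ofDual (TrapFree.hasFold_of_lt (α := αᵒᵈ) hT hg hpx hp hx)

/-- A trap-free map without folds and with two fixed points is the identity. -/
theorem TrapFree.eq_id (hT : TrapFree g) (hg : Continuous g) (hF : ¬ HasFold g) {u v : α}
    (huv : u < v) (hu : g u = u) (hv : g v = v) : g = id := by
  have hclosed : IsClosed {t | g t = t} := isClosed_eq hg continuous_id
  obtain ⟨p, hp, hpmin⟩ := hclosed.isCompact.exists_isLeast ⟨u, hu⟩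
  obtain ⟨q, hq, hqmax⟩ := hclosed.isCompact.exists_isGreatest ⟨u, hu⟩
  have hpq : p < q := (hpmin hu).trans_lt (huv.trans_le (hqmax hv))
  have hleft : ∀ t < p, t < g t := fun t ht =>
    lt_of_not_ge fun h => h.lt_or_eq.elim
      (fun h => hF (hT.hasFold_of_gt hg ht hp h)) (fun h => (hpmin h).not_gt ht)
  have hright : ∀ t, q < t → g t < t := fun t ht =>
    lt_of_not_ge fun h => h.lt_or_eq.elim
      (fun h => hF (hT.hasFold_of_lt hg ht hq h)) (fun h => (hqmax h.symm).not_gt ht)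
  have hmid : ∀ t ∈ Icc p q, g t = t := by
    rintro t ⟨hpt, htq⟩
    rcases hpt.eq_or_lt with rfl | hpt
    · exact hp
    rcases htq.eq_or_lt with rfl | htq
    · exact hq
    refine le_antisymm (le_of_not_gt fun h => hF (hT.hasFold_of_lt hg hpt hp h))
      (le_of_not_gt fun h => hF (hT.hasFold_of_gt hg htq hq h))
  obtain ⟨l, hlp, hl, hl', hlu⟩ := exists_left_barrier hg hp hpq hleft
  obtain ⟨r, hqr, hr, hr', hru⟩ : ∃ r, q ≤ r ∧ (∀ t, t ≤ q → Iic r ∈ nhds t) ∧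
      (∀ t, q ≤ t ∧ t ≤ r → Iic r ∈ nhds (g t) ∧ p < g t) ∧
      (Iic r = univ → Iic q = univ) := by
    obtain ⟨r, h1, h2, h3, h4⟩ := exists_left_barrier (α := αᵒᵈ) hg hq hpq hright
    exact ⟨r, h1, h2, fun t ht => h3 t ⟨ht.2, ht.1⟩, h4⟩
  have huniv : Icc l r = univ := hT _ isClosed_Icc
      ⟨p, hlp, hpq.le.trans hqr⟩ fun t ht => by
    rw [mem_interior_iff_mem_nhds, ← Ici_inter_Iic]
    rcases le_total t p with htp | hpt
    · obtain ⟨h1, h2⟩ := hl' t ⟨ht.1, htp⟩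
      exact Filter.inter_mem h1 (hr _ h2.le)
    rcases le_total t q with htq | hqt
    · rw [hmid t ⟨hpt, htq⟩]
      exact Filter.inter_mem (hl _ hpt) (hr _ htq)
    · obtain ⟨h1, h2⟩ := hr' t ⟨hqt, ht.2⟩
      exact Filter.inter_mem (hl _ h2.le) h1
  have h1 := hlu (eq_univ_of_forall fun t => (huniv ▸ mem_univ t : t ∈ Icc l r).1)
  have h2 := hru (eq_univ_of_forall fun t => (huniv ▸ mem_univ t : t ∈ Icc l r).2)
  funext t
  exact hmid t ⟨(h1 ▸ mem_univ t : t ∈ Ici p), (h2 ▸ mem_univ t : t ∈ Iic q)⟩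

end Order

/-- Maps in the closure of `CP` are trap-free. -/
theorem trapFree_of_mem_closure_CP {f : C(unitI, unitI)} (hf : f ∈ closure CP) :
    TrapFree f := by
  intro K hK hne hfK
  obtain ⟨h, hhK, -, hper⟩ := mem_closure_iff.1 hf _
    (ContinuousMap.isOpen_setOfPred_mapsTo hK.isCompact isOpen_interior) hfK
  have himg : IsClosed (h '' K) := (hK.isCompact.image h.continuous).isClosed
  have heq : interior K = h '' K := by
    refine Subset.antisymm (fun x hx => by_contra fun hxK => ?_) (image_subset_iff.2 hhK)
    obtain ⟨z, ⟨hzK, hzh⟩, n, hn, hz⟩ := hper.inter_open_nonempty _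
      (isOpen_interior.sdiff himg) ⟨x, hx, hxK⟩
    have hmem : ∀ k, h^[k] z ∈ K := fun k =>
      (hhK.mono_right interior_subset).iterate k (interior_subset hzK)
    refine hzh ⟨h^[n - 1] z, hmem _, ?_⟩
    rw [← iterate_succ_apply' h, Nat.succ_eq_add_one, Nat.sub_add_cancel hn]
    exact hz
  have : interior K = univ :=
    IsClopen.eq_univ ⟨heq ▸ himg, isOpen_interior⟩ (heq ▸ hne.image _)
  exact univ_subset_iff.1 (this ▸ interior_subset)

theorem surjective_of_mem_closure_CP {f : C(unitI, unitI)} (hf : f ∈ closure CP) :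
    Surjective f := by
  intro y
  by_contra! hy
  obtain ⟨h, hh, hsurj, -⟩ := mem_closure_iff.1 hf _
    (ContinuousMap.isOpen_setOfPred_mapsTo isCompact_univ (isOpen_compl_singleton (x := y)))
    (fun x _ => hy x)
  obtain ⟨x, hx⟩ := hsurj y
  exact hh (mem_univ x) hx

theorem comp_self_mem_closure_CP {f : C(unitI, unitI)} (hf : f ∈ closure CP) :
    f.comp f ∈ closure CP := by
  refine map_mem_closure (f := fun h : C(unitI, unitI) => h.comp h)
    (continuous_id.compCM continuous_id) hf ?_
  rintro h ⟨hs, hd⟩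
  refine ⟨hs.comp hs, hd.mono ?_⟩
  rintro x ⟨n, hn, hx⟩
  exact ⟨n, hn, by simpa [IsPeriodicPt, IsFixedPt] using (hx.iterate 2)⟩

/-- For maps in the closure of `CP`, either the second iterate is the identity or it has a fold. -/
theorem hasFold_comp_self {f : C(unitI, unitI)} (hf : f ∈ closure CP) (hne : f ∘ f ≠ id) :
    HasFold (f ∘ f) := by
  by_contra hF
  have hT : TrapFree (f ∘ f) := trapFree_of_mem_closure_CP (comp_self_mem_closure_CP hf)
  have hg : Continuous (f ∘ f) := f.continuous.comp f.continuous
  have huniq : ∀ u v, f (f u) = u → f (f v) = v → u = v := by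
    intro u v hu hv
    by_contra h
    rcases lt_or_gt_of_ne h with h | h
    · exact hne (hT.eq_id hg hF h hu hv)
    · exact hne (hT.eq_id hg hF h hv hu)
  obtain ⟨p, hp⟩ : ∃ p, f p = p :=
    intermediate_value_univ₂ (a := 1) (b := 0) f.continuous continuous_id
      unitInterval.le_one' unitInterval.nonneg'
  have hpp : f (f p) = p := by rw [hp, hp]
  obtain ⟨z, hz⟩ := surjective_of_mem_closure_CP hf 1
  obtain ⟨y, hy⟩ := surjective_of_mem_closure_CP hf 0
  have hzp : z ≤ p := by
    by_contra! h
    obtain ⟨t, ht, htf⟩ := isPreconnected_Icc.intermediate_value₂ (s := Icc z 1)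
      (right_mem_Icc.2 unitInterval.le_one') (left_mem_Icc.2 unitInterval.le_one')
      f.continuous.continuousOn continuousOn_id unitInterval.le_one'
      (by rw [hz]; exact unitInterval.le_one')
    have htf : f t = t := htf
    exact (h.trans_le ht.1).ne (huniq p t hpp (by rw [htf, htf]))
  have hpy : p ≤ y := by
    by_contra! h
    obtain ⟨t, ht, htf⟩ := isPreconnected_Icc.intermediate_value₂ (s := Icc 0 y)
      (right_mem_Icc.2 unitInterval.nonneg') (left_mem_Icc.2 unitInterval.nonneg')
      f.continuous.continuousOn continuousOn_id (by rw [hy]; exact unitInterval.nonneg')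
      unitInterval.nonneg'
    have htf : f t = t := htf
    exact (ht.2.trans_lt h).ne (huniq t p (by rw [htf, htf]) hpp)
  obtain ⟨w, hw, hfw⟩ := intermediate_value_Icc' hzp f.continuous.continuousOn
    ⟨hp.trans_le hpy, hz.symm ▸ unitInterval.le_one'⟩
  have hgw : f (f w) = 0 := by rw [hfw, hy]
  have hwp : w ≠ p := by
    rintro rfl
    have h0 : w = 0 := hpp.symm.trans hgw
    have : z = w := le_antisymm hzp (h0 ▸ unitInterval.nonneg')
    subst this
    exact zero_ne_one ((h0.symm.trans hp.symm).trans hz)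
  have hw0 : (0 : unitI) < w := by
    refine lt_of_le_of_ne unitInterval.nonneg' fun h => hwp (huniq w p ?_ hpp)
    rw [hgw, h]
  exact hF (hT.hasFold_of_gt hg (hw.2.lt_of_ne hwp) hpp (hgw.trans_lt hw0))

/-- A map of the interval whose square is the identity has zero entropy. -/
theorem hTop_nonpos_of_comp_self_eq_id {f : unitI → unitI} (hf : Continuous f)
    (h : f ∘ f = id) : hTop f ≤ 0 := by
  refine iSup₂_le fun U hU => ?_
  obtain ⟨s, hs⟩ := exists_isDynCoverOf_of_isCompact_uniformContinuous (T := f) isCompact_univ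
    (CompactSpace.uniformContinuous_of_continuous hf) hU 2
  have hdyn : ∀ n, dynEntourage f U 2 ⊆ dynEntourage f U n := by
    rintro n ⟨x, y⟩ hxy
    rw [mem_dynEntourage] at hxy ⊢
    have hper : ∀ k, f^[k] = f^[k % 2] := fun k => by
      conv_lhs => rw [← Nat.mod_add_div k 2, iterate_add, iterate_mul]
      rw [show f^[2] = id from h, iterate_id, comp_id]
    intro k _
    rw [hper k]
    exact hxy _ (Nat.mod_lt _ two_pos)
  have hcard : ∀ n, coverMincard f univ U n ≤ (s.card : ℕ∞) := fun n =>
    IsDynCoverOf.coverMincard_le_card fun x hx => by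
      obtain ⟨y, hy, hxy⟩ := hs hx
      exact ⟨y, hy, hdyn n hxy⟩
  calc coverEntropyEntourage f univ U
      ≤ ExpGrowth.expGrowthSup fun _ => ((s.card + 1 : ℕ) : ENNReal) := by
        refine ExpGrowth.expGrowthSup_monotone fun n => ?_
        refine (ENat.toENNReal_mono (hcard n)).trans ?_
        rw [ENat.toENNReal_coe]
        exact_mod_cast Nat.le_succ _
    _ = 0 := ExpGrowth.expGrowthSup_const (by simp) (by simp)

section Horseshoe

variable {X : Type*} {g : X → X} {S : Bool → Set X}

theorem exists_itinerary (hcov : ∀ b b', S b' ⊆ g '' S b) (hne : ∀ b, (S b).Nonempty)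
    (n : ℕ) (w : ℕ → Bool) : ∃ x, ∀ i ≤ n, g^[i] x ∈ S (w i) := by
  induction n generalizing w with
  | zero =>
    obtain ⟨x, hx⟩ := hne (w 0)
    exact ⟨x, fun i hi => by simpa [Nat.le_zero.1 hi] using hx⟩
  | succ n ih =>
    obtain ⟨z, hz⟩ := ih fun i => w (i + 1)
    obtain ⟨x, hx, rfl⟩ := hcov (w 0) _ (hz 0 n.zero_le)
    refine ⟨x, fun i hi => ?_⟩
    cases i with
    | zero => exact hx
    | succ i => exact hz i (Nat.le_of_succ_le_succ hi)

/-- The points following the itinerary `u` for `m` steps and lying in `S false` at time `m + 1`. -/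
def itineraryBlock (g : X → X) (S : Bool → Set X) {m : ℕ} (u : Fin m → Bool) : Set X :=
  {x | (∀ i : Fin m, g^[i] x ∈ S (u i)) ∧ g^[m + 1] x ∈ S false}

theorem disjoint_itineraryBlock {a c y : X} (hS : S true ∩ S false ⊆ {c}) (hc : g c = y)
    (hy : g y = a) (ha : g a = a) (haS : a ∉ S false) {m : ℕ} {u v : Fin m → Bool}
    (huv : u ≠ v) : Disjoint (itineraryBlock g S u) (itineraryBlock g S v) := by
  refine Set.disjoint_left.2 fun x hu hv => haS ?_
  obtain ⟨i, hi⟩ := Function.ne_iff.1 huv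
  have hxc : g^[i] x = c := by
    refine hS ?_
    have h1 := hu.1 i
    have h2 := hv.1 i
    cases hui : u i <;> cases hvi : v i <;> simp_all
  have hxa : g^[m + 1] x = a := by
    obtain ⟨k, hk⟩ : ∃ k, m + 1 = k + (2 + i) := ⟨m - 1 - i, by lia⟩
    rw [hk, iterate_add_apply, iterate_add_apply, hxc]
    change g^[k] (g (g c)) = a
    rw [hc, hy]
    exact iterate_fixed ha k
  exact hxa ▸ hu.2

theorem isClosed_itineraryBlock [TopologicalSpace X] (hg : Continuous g)
    (hS : ∀ b, IsClosed (S b)) {m : ℕ} (u : Fin m → Bool) :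
    IsClosed (itineraryBlock g S u) := by
  rw [itineraryBlock, ofPred_and, ofPred_forall]
  exact (isClosed_iInter fun i => (hS _).preimage (hg.iterate _)).inter
    ((hS _).preimage (hg.iterate _))

theorem exists_mem_itineraryBlock (hcov : ∀ b b', S b' ⊆ g '' S b) (hne : ∀ b, (S b).Nonempty)
    {m k : ℕ} (v : Fin k → Fin m → Bool) :
    ∃ x, ∀ j : Fin k, g^[j * (m + 2)] x ∈ itineraryBlock g S (v j) := by
  obtain ⟨x, hx⟩ := exists_itinerary hcov hne (k * (m + 2)) fun i =>
    if h : i / (m + 2) < k ∧ i % (m + 2) < m then v ⟨_, h.1⟩ ⟨_, h.2⟩ else false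
  refine ⟨x, fun j => ?_⟩
  have hle : ∀ i < m + 2, i + j * (m + 2) ≤ k * (m + 2) := fun i hi => by
    have : (j + 1) * (m + 2) ≤ k * (m + 2) := Nat.mul_le_mul_right _ j.2
    lia
  have hdiv : ∀ i < m + 2, (i + j * (m + 2)) / (m + 2) = j := fun i hi => by
    rw [Nat.add_mul_div_right _ _ (by lia), Nat.div_eq_of_lt hi, zero_add]
  have hmod : ∀ i < m + 2, (i + j * (m + 2)) % (m + 2) = i := fun i hi => by
    rw [Nat.add_mul_mod_self_right, Nat.mod_eq_of_lt hi]
  refine ⟨fun i => ?_, ?_⟩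
  · have hi : (i : ℕ) < m + 2 := by lia
    rw [← iterate_add_apply]
    simpa [hdiv i hi, hmod i hi] using hx _ (hle i hi)
  · rw [← iterate_add_apply]
    simpa [hdiv (m + 1) (by lia), hmod (m + 1) (by lia)] using hx _ (hle (m + 1) (by lia))

/-- Pairwise disjoint blocks of length `m` force exponentially many separated orbits. -/
theorem exists_entourage_pow_le_netMaxcard [UniformSpace X] [CompactSpace X] {f : X → X}
    (hf : Continuous f) (hS : ∀ b, IsClosed (S b)) (hcov : ∀ b b', S b' ⊆ (f ∘ f) '' S b)
    (hne : ∀ b, (S b).Nonempty) {m : ℕ}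
    (hdisj : ∀ u v : Fin m → Bool, u ≠ v →
      Disjoint (itineraryBlock (f ∘ f) S u) (itineraryBlock (f ∘ f) S v)) :
    ∃ V ∈ uniformity X, ∀ k : ℕ,
      (((2 ^ m) ^ k : ℕ) : ℕ∞) ≤ netMaxcard f univ V (k * (2 * (m + 2))) := by
  classical
  have hclosed := isClosed_itineraryBlock (m := m) (hf.comp hf) hS
  have hsep : ∀ p : (Fin m → Bool) × (Fin m → Bool), ∃ V ∈ uniformity X, p.1 ≠ p.2 →
      Disjoint (⋃ x ∈ itineraryBlock (f ∘ f) S p.1, UniformSpace.ball x V)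
        (⋃ x ∈ itineraryBlock (f ∘ f) S p.2, UniformSpace.ball x V) := fun p => by
    by_cases hp : p.1 = p.2
    · exact ⟨univ, Filter.univ_mem, fun h => absurd hp h⟩
    · obtain ⟨V, hV, h⟩ :=
        (hdisj _ _ hp).exists_uniform_thickening (hclosed p.1).isCompact (hclosed p.2)
      exact ⟨V, hV, fun _ => h⟩
  choose V hV hVsep using hsep
  refine ⟨⋂ p, V p, Filter.iInter_mem.2 hV, fun k => ?_⟩
  choose x hx using fun v : Fin k → Fin m → Bool => exists_mem_itineraryBlock hcov hne v
  have hiter : ∀ n z, f^[2 * n] z = (f ∘ f)^[n] z := fun n z => by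
    rw [iterate_mul]; rfl
  have hball : ∀ v v', v ≠ v' →
      Disjoint (UniformSpace.ball (x v) (dynEntourage f (⋂ p, V p) (k * (2 * (m + 2)))))
        (UniformSpace.ball (x v') (dynEntourage f (⋂ p, V p) (k * (2 * (m + 2))))) := by
    intro v v' hvv'
    obtain ⟨j, hj⟩ := Function.ne_iff.1 hvv'
    refine Set.disjoint_left.2 fun z hz hz' => ?_
    rw [mem_ball_dynEntourage] at hz hz'
    have ht : 2 * (j * (m + 2)) < k * (2 * (m + 2)) := by
      have : (j + 1) * (m + 2) ≤ k * (m + 2) := Nat.mul_le_mul_right _ j.2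
      lia
    have h1 := hz _ ht
    have h2 := hz' _ ht
    rw [hiter, hiter] at h1 h2
    exact Set.disjoint_left.1 (hVsep (v j, v' j) hj)
      (mem_iUnion₂.2 ⟨_, hx v j, UniformSpace.ball_mono (iInter_subset _ _) _ h1⟩)
      (mem_iUnion₂.2 ⟨_, hx v' j, UniformSpace.ball_mono (iInter_subset _ _) _ h2⟩)
  have hrefl : ∀ z, z ∈ UniformSpace.ball z (dynEntourage f (⋂ p, V p) (k * (2 * (m + 2)))) :=
    fun z => mem_ball_dynEntourage.2 fun _ _ =>
      UniformSpace.mem_ball_self _ (Filter.iInter_mem.2 hV)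
  have hinj : Injective x := fun v v' h => by
    by_contra hne
    exact Set.disjoint_left.1 (hball v v' hne) (hrefl _) (h ▸ hrefl _)
  have hnet : IsDynNetIn f univ (⋂ p, V p) (k * (2 * (m + 2)))
      (Finset.univ.image x : Finset X) := by
    refine ⟨subset_univ _, ?_⟩
    rw [Finset.coe_image, Finset.coe_univ, image_univ]
    rintro _ ⟨v, rfl⟩ _ ⟨v', rfl⟩ h
    exact hball v v' fun hv => h (hv ▸ rfl)
  simpa [Finset.card_image_of_injective _ hinj] using hnet.card_le_netMaxcard

end Horseshoe

theorem le_coverEntropy_of_pow_le_netMaxcard {X : Type*} [UniformSpace X] {f : X → X}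
    {V : SetRel X X} (hV : V ∈ uniformity X) {m N : ℕ} (hN : 0 < N)
    (h : ∀ k : ℕ, (((2 ^ m) ^ k : ℕ) : ℕ∞) ≤ netMaxcard f univ V (k * N)) :
    ((m * Real.log 2 / N : ℝ) : EReal) ≤ coverEntropy f univ := by
  refine le_trans ?_ (netEntropyEntourage_le_coverEntropy f univ hV)
  refine Filter.le_limsup_of_frequently_le' (Filter.frequently_atTop.2 fun n => ?_)
  refine ⟨(n + 1) * N, (Nat.le_succ n).trans (Nat.le_mul_of_pos_right _ hN), ?_⟩
  have hpos : 0 < (n + 1) * N := by positivity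
  rw [EReal.le_div_iff_mul_le (by exact_mod_cast hpos) (EReal.natCast_ne_top _)]
  have hle := ENat.toENNReal_mono (h (n + 1))
  rw [ENat.toENNReal_coe] at hle
  refine le_trans (le_of_eq ?_) (ENNReal.log_monotone hle)
  have hcast : (((2 ^ m) ^ (n + 1) : ℕ) : ENNReal) = ENNReal.ofReal (2 ^ (m * (n + 1))) := by
    rw [← ENNReal.ofReal_natCast]; push_cast; rw [pow_mul]
  rw [hcast, ENNReal.log_ofReal_of_pos (by positivity), Real.log_pow]
  have : ((((n + 1) * N : ℕ)) : EReal) = (((n + 1) * N : ℝ) : EReal) := by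
    rw [← EReal.coe_natCast]; push_cast; rfl
  rw [this, ← EReal.coe_mul]
  congr 1
  push_cast
  field_simp

/-- The two intervals determined by a fold of `g`. -/
def foldInterval (a c y : unitI) (b : Bool) : Set unitI := if b then uIcc a c else uIcc c y

section Fold

variable {g : unitI → unitI} {a c y : unitI}

theorem foldInterval_subset_image (hg : Continuous g)
    (hlt : a < c ∧ c < y ∨ y < c ∧ c < a) (ha : g a = a) (hc : g c = y) (hy : g y = a)
    (b b' : Bool) : foldInterval a c y b' ⊆ g '' foldInterval a c y b := by
  have hcay : c ∈ uIcc a y := by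
    rcases hlt with h | h
    · exact mem_uIcc_of_le h.1.le h.2.le
    · exact mem_uIcc_of_ge h.1.le h.2.le
  have h1 : foldInterval a c y b' ⊆ uIcc a y := by
    cases b'
    · exact uIcc_subset_uIcc hcay right_mem_uIcc
    · exact uIcc_subset_uIcc left_mem_uIcc hcay
  refine h1.trans ?_
  cases b
  · have := intermediate_value_uIcc (a := c) (b := y) hg.continuousOn
    rwa [hc, hy, uIcc_comm] at this
  · have := intermediate_value_uIcc (a := a) (b := c) hg.continuousOn
    rwa [ha, hc] at this

theorem foldInterval_inter_subset (hlt : a < c ∧ c < y ∨ y < c ∧ c < a) :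
    foldInterval a c y true ∩ foldInterval a c y false ⊆ {c} := by
  rintro x ⟨h1, h2⟩
  simp only [foldInterval, if_true, Bool.false_eq_true, if_false] at h1 h2
  rcases hlt with h | h
  · rw [uIcc_of_le h.1.le] at h1
    rw [uIcc_of_le h.2.le] at h2
    exact le_antisymm h1.2 h2.1
  · rw [uIcc_of_ge h.2.le] at h1
    rw [uIcc_of_ge h.1.le] at h2
    exact le_antisymm h2.2 h1.1

theorem notMem_foldInterval (hlt : a < c ∧ c < y ∨ y < c ∧ c < a) :
    a ∉ foldInterval a c y false := by
  intro h
  simp only [foldInterval, Bool.false_eq_true, if_false] at h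
  rcases hlt with h' | h'
  · rw [uIcc_of_le h'.2.le] at h
    exact h'.1.not_ge h.1
  · rw [uIcc_of_ge h'.1.le] at h
    exact h'.2.not_ge h.2

end Fold

theorem HasFold.turbulent {g : unitI → unitI} (hg : Continuous g) (h : HasFold g) :
    Turbulent g := by
  obtain ⟨a, c, y, hlt, ha, hc, hy⟩ := h
  have hcov := foldInterval_subset_image hg hlt ha hc hy
  have hsub : (foldInterval a c y true ∩ foldInterval a c y false).Subsingleton :=
    subsingleton_singleton.anti (foldInterval_inter_subset hlt)
  have hall := union_subset (subset_inter (hcov true true) (hcov false true))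
    (subset_inter (hcov true false) (hcov false false))
  simp only [foldInterval, if_true, Bool.false_eq_true, if_false] at hsub hall
  rcases hlt with h | h
  · rw [uIcc_of_le h.1.le, uIcc_of_le h.2.le] at hsub hall
    exact ⟨a, c, c, y, h.1, h.2, hsub, hall⟩
  · rw [uIcc_of_ge h.1.le, uIcc_of_ge h.2.le] at hsub hall
    exact ⟨c, a, y, c, h.2, h.1, hsub, hall⟩

theorem foldInterval_nonempty (a c y : unitI) (b : Bool) : (foldInterval a c y b).Nonempty := by
  cases b
  · exact nonempty_uIcc
  · exact nonempty_uIcc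

theorem HasFold.log_two_div_two_le_hTop {f : unitI → unitI} (hf : Continuous f)
    (h : HasFold (f ∘ f)) : ((Real.log 2 / 2 : ℝ) : EReal) ≤ hTop f := by
  obtain ⟨a, c, y, hlt, ha, hc, hy⟩ := h
  have hclosed : ∀ b, IsClosed (foldInterval a c y b) := by
    rintro (_ | _)
    · exact isClosed_Icc
    · exact isClosed_Icc
  have hbound : ∀ m : ℕ, ((Real.log 2 / 2 * (m / (m + 2)) : ℝ) : EReal) ≤ hTop f := fun m => by
    obtain ⟨V, hV, h⟩ := exists_entourage_pow_le_netMaxcard (m := m) hf hclosed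
      (foldInterval_subset_image (hf.comp hf) hlt ha hc hy) (foldInterval_nonempty a c y)
      fun u v => disjoint_itineraryBlock (foldInterval_inter_subset hlt) hc hy ha
        (notMem_foldInterval hlt)
    refine le_trans (EReal.coe_le_coe_iff.2 (le_of_eq ?_))
      (le_coverEntropy_of_pow_le_netMaxcard hV (by positivity) h)
    push_cast
    field_simp
  have hlim := (tendsto_natCast_div_add_atTop (2 : ℝ)).const_mul (Real.log 2 / 2)
  rw [mul_one] at hlim
  exact le_of_tendsto' ((continuous_coe_real_ereal.tendsto _).comp hlim) hbound

/-- If the image of an interval contains `p` and `q`, some subinterval is mapped into the interval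
between `p` and `q`, with endpoints mapped to `p` and `q`. -/
theorem exists_subinterval {g : unitI → unitI} (hg : Continuous g) {a b p q : unitI}
    (hp : p ∈ g '' uIcc a b) (hq : q ∈ g '' uIcc a b) :
    ∃ u v, uIcc u v ⊆ uIcc a b ∧ g u = p ∧ g v = q ∧ MapsTo g (uIcc u v) (uIcc p q) := by
  obtain ⟨u₀, hu₀, hgu₀⟩ := hp
  obtain ⟨v₀, hv₀, hgv₀⟩ := hq
  have hfib : ∀ r, IsCompact {t | t ∈ uIcc a b ∧ g t = r} := fun r =>
    (isClosed_Icc.inter (isClosed_eq hg continuous_const)).isCompact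
  obtain ⟨⟨u, v⟩, ⟨⟨hu, hgu⟩, hv, hgv⟩, hmin⟩ := ((hfib p).prod (hfib q)).exists_isMinOn
    ⟨(u₀, v₀), ⟨hu₀, hgu₀⟩, hv₀, hgv₀⟩ (continuous_dist.continuousOn)
  have hsub : uIcc u v ⊆ uIcc a b := uIcc_subset_uIcc hu hv
  have habs : ∀ x z : unitI, dist x z = |(x : ℝ) - z| := fun _ _ => rfl
  have hclose : ∀ x t z : unitI, t ∈ uIcc x z → t ≠ x → dist t z < dist x z := by
    intro x t z ht htx
    have htx' : (t : ℝ) ≠ x := fun h => htx (Subtype.ext h)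
    rw [habs, habs]
    rcases mem_uIcc.1 ht with ⟨h1, h2⟩ | ⟨h1, h2⟩
    · have h1' : (x : ℝ) < t := lt_of_le_of_ne h1 htx'.symm
      have h2' : (t : ℝ) ≤ z := h2
      rw [abs_of_nonpos (by linarith), abs_of_nonpos (by linarith)]
      linarith
    · have h1' : (z : ℝ) ≤ t := h1
      have h2' : (t : ℝ) < x := lt_of_le_of_ne h2 htx'
      rw [abs_of_nonneg (by linarith), abs_of_nonneg (by linarith)]
      linarith
  refine ⟨u, v, hsub, hgu, hgv, fun t ht => ?_⟩
  have huIcc := intermediate_value_uIcc (f := g) (a := t) (b := v) hg.continuousOn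
  have huIcc' := intermediate_value_uIcc (f := g) (a := u) (b := t) hg.continuousOn
  by_contra hgt
  have hcase : p ∈ uIcc (g t) q ∨ q ∈ uIcc p (g t) := by
    simp only [mem_uIcc] at hgt ⊢
    rcases le_total p q with h | h <;> rcases le_total (g t) p with h1 | h1 <;>
      rcases le_total (g t) q with h2 | h2 <;> tauto
  rcases hcase with h | h
  · obtain ⟨s, hs, hgs⟩ := huIcc (by rwa [hgv])
    have hsuv : s ∈ uIcc u v := uIcc_subset_uIcc ht right_mem_uIcc hs
    refine (hmin (a := (s, v)) ⟨⟨hsub hsuv, hgs⟩, hv, hgv⟩ : dist u v ≤ dist s v).not_gt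
      (hclose u s v hsuv ?_)
    rintro rfl
    have : t = s := by
      by_contra hts
      have h1 := hclose s t v ht hts
      by_cases hst : s = t
      · exact hts hst.symm
      · exact absurd (hclose t s v hs hst) h1.not_gt
    exact hgt (this ▸ hgs.symm ▸ left_mem_uIcc)
  · obtain ⟨s, hs, hgs⟩ := huIcc' (by rwa [hgu])
    have hsuv : s ∈ uIcc u v := uIcc_subset_uIcc left_mem_uIcc ht hs
    have hsv : s ∈ uIcc v u := uIcc_comm u v ▸ hsuv
    have hle : dist u v ≤ dist u s := hmin (a := (u, s)) ⟨⟨hu, hgu⟩, hsub hsuv, hgs⟩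
    rw [dist_comm u v, dist_comm u s] at hle
    refine hle.not_gt (hclose v s u hsv ?_)
    rintro rfl
    have : t = s := by
      by_contra hts
      have h1 := hclose s t u (uIcc_comm u s ▸ ht) hts
      exact absurd (hclose t s u (uIcc_comm u t ▸ hs) (Ne.symm hts)) h1.not_gt
    exact hgt (this ▸ hgs.symm ▸ right_mem_uIcc)

/-- Two intervals `R`, `L` with `R` covering both and `L` covering `R` carry a periodic orbit that
visits `R` for `n` steps and then `L` once. -/
theorem exists_loop {g : unitI → unitI} (hg : Continuous g) {r₁ r₂ l₁ l₂ : unitI}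
    (hRR : uIcc r₁ r₂ ⊆ g '' uIcc r₁ r₂) (hRL : uIcc l₁ l₂ ⊆ g '' uIcc r₁ r₂)
    (hLR : uIcc r₁ r₂ ⊆ g '' uIcc l₁ l₂) {n : ℕ} (hn : 0 < n) :
    ∃ x, g^[n + 1] x = x ∧ (∀ i < n, g^[i] x ∈ uIcc r₁ r₂) ∧ g^[n] x ∈ uIcc l₁ l₂ := by
  have key : ∀ n, ∃ u v, u ∈ g '' uIcc r₁ r₂ ∧ v ∈ g '' uIcc r₁ r₂ ∧
      (∀ i < n, MapsTo g^[i] (uIcc u v) (uIcc r₁ r₂)) ∧ g^[n] u = l₁ ∧ g^[n] v = l₂ ∧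
      MapsTo g^[n] (uIcc u v) (uIcc l₁ l₂) := by
    intro n
    induction n with
    | zero =>
      exact ⟨l₁, l₂, hRL left_mem_uIcc, hRL right_mem_uIcc, by simp, rfl, rfl, mapsTo_id _⟩
    | succ n ih =>
      obtain ⟨u, v, hu, hv, hR, hu', hv', hL⟩ := ih
      obtain ⟨s, t, hst, rfl, rfl, hmaps⟩ := exists_subinterval hg hu hv
      refine ⟨s, t, hRR (hst left_mem_uIcc), hRR (hst right_mem_uIcc), fun i hi => ?_, hu', hv',
        hL.comp hmaps⟩
      cases i with
      | zero => exact hst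
      | succ i => exact (hR i (Nat.lt_of_succ_lt_succ hi)).comp hmaps
  obtain ⟨u, v, -, -, hR, hu, hv, hL⟩ := key n
  have hsurj : uIcc u v ⊆ g^[n + 1] '' uIcc u v := by
    rw [iterate_succ', image_comp]
    have := intermediate_value_uIcc (a := u) (b := v) (hg.iterate n).continuousOn
    rw [hu, hv] at this
    have h0 : uIcc u v ⊆ uIcc r₁ r₂ := hR 0 hn
    exact (h0.trans hLR).trans (image_mono this)
  obtain ⟨s, hs, hgs⟩ := hsurj (show u ⊓ v ∈ uIcc u v from ⟨le_rfl, inf_le_sup⟩)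
  obtain ⟨t, ht, hgt⟩ := hsurj (show u ⊔ v ∈ uIcc u v from ⟨inf_le_sup, le_rfl⟩)
  obtain ⟨x, hx, hgx⟩ := isPreconnected_uIcc.intermediate_value₂ hs ht
    (hg.iterate (n + 1)).continuousOn continuousOn_id (hgs.trans_le hs.1) (ht.2.trans_eq hgt.symm)
  exact ⟨x, hgx, fun i hi => hR i hi hx, hL hx⟩

theorem eq_six_of_dvd {d : ℕ} (h6 : d ∣ 6) (h2 : ¬ d ∣ 2) (h3 : ¬ d ∣ 3) : d = 6 := by
  have hle := Nat.le_of_dvd (by norm_num) h6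
  interval_cases d <;> simp_all

/-- A cycle `p ↦ q ↦ r ↦ p` with `p` in the middle forces a point of period six. -/
theorem exists_minimalPeriod_six_of_cycle {f : unitI → unitI} (hf : Continuous f)
    {p q r : unitI} (hlt : q < p ∧ p < r ∨ r < p ∧ p < q) (hp : f p = q) (hq : f q = r)
    (hr : f r = p) : ∃ x, minimalPeriod f x = 6 := by
  have hpqr : p ∈ uIcc q r := by
    rcases hlt with h | h
    · exact mem_uIcc_of_le h.1.le h.2.le
    · exact mem_uIcc_of_ge h.1.le h.2.le
  have hR := intermediate_value_uIcc (f := f) (a := p) (b := q) hf.continuousOn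
  have hL := intermediate_value_uIcc (f := f) (a := p) (b := r) hf.continuousOn
  rw [hp, hq] at hR
  rw [hp, hr, uIcc_comm q p] at hL
  obtain ⟨x, hx, hxR, hxL⟩ := exists_loop hf ((uIcc_subset_uIcc hpqr left_mem_uIcc).trans hR)
    ((uIcc_subset_uIcc hpqr right_mem_uIcc).trans hR) hL (n := 5) (by norm_num)
  have hinter : ∀ z, z ∈ uIcc p q → z ∈ uIcc p r → z = p := by
    intro z h1 h2
    rcases hlt with h | h
    · rw [uIcc_of_ge h.1.le] at h1
      rw [uIcc_of_le h.2.le] at h2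
      exact le_antisymm h1.2 h2.1
    · rw [uIcc_of_le h.2.le] at h1
      rw [uIcc_of_ge h.1.le] at h2
      exact le_antisymm h2.2 h1.1
  have hrp : r ≠ p := by rcases hlt with h | h; exacts [h.2.ne', h.1.ne]
  have hpr : f^[2] p = r := (congrArg f hp).trans hq
  have hne3 : f^[3] x ≠ x := fun h3 => by
    have h5 : f^[5] x = f^[2] x := (iterate_add_apply f 2 3 x).trans (congrArg _ h3)
    have h2 := hinter _ (hxR 2 (by norm_num)) (h5 ▸ hxL)
    have h4 : f^[4] x = r := (iterate_add_apply f 2 2 x).trans ((congrArg _ h2).trans hpr)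
    exact hrp (hinter r (h4 ▸ hxR 4 (by norm_num)) right_mem_uIcc)
  have hne2 : f^[2] x ≠ x := fun h2 => by
    have h5 : f^[5] x = f^[3] x := (iterate_add_apply f 3 2 x).trans (congrArg _ h2)
    have h3 := hinter _ (hxR 3 (by norm_num)) (h5 ▸ hxL)
    have h5' : f^[5] x = r := (iterate_add_apply f 2 3 x).trans ((congrArg _ h3).trans hpr)
    exact hrp (h5'.symm.trans (h5.trans h3))
  refine ⟨x, ?_⟩
  have hdvd : minimalPeriod f x ∣ 6 := IsPeriodicPt.minimalPeriod_dvd hx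
  have h2 : ¬ minimalPeriod f x ∣ 2 := fun h => hne2 ((isPeriodicPt_iff_minimalPeriod_dvd).2 h)
  have h3 : ¬ minimalPeriod f x ∣ 3 := fun h => hne3 ((isPeriodicPt_iff_minimalPeriod_dvd).2 h)
  exact eq_six_of_dvd hdvd h2 h3

theorem exists_minimalPeriod_six_of_three {f : unitI → unitI} (hf : Continuous f) {x : unitI}
    (h3 : f (f (f x)) = x) (h1 : f x ≠ x) : ∃ z, minimalPeriod f z = 6 := by
  have h12 : f (f x) ≠ f x := fun h => h1 (by rw [h, h] at h3; exact h3)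
  have h20 : f (f x) ≠ x := fun h => h1 (by rw [h] at h3; exact h3)
  rcases lt_or_gt_of_ne h1 with a | a <;> rcases lt_or_gt_of_ne h12 with b | b <;>
    rcases lt_or_gt_of_ne h20 with c | c
  all_goals first
    | exact exists_minimalPeriod_six_of_cycle hf (.inl ⟨a, c⟩) rfl rfl h3
    | exact exists_minimalPeriod_six_of_cycle hf (.inr ⟨c, a⟩) rfl rfl h3
    | exact exists_minimalPeriod_six_of_cycle hf (.inl ⟨b, a⟩) rfl h3 rfl
    | exact exists_minimalPeriod_six_of_cycle hf (.inr ⟨a, b⟩) rfl h3 rfl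
    | exact exists_minimalPeriod_six_of_cycle hf (.inl ⟨c, b⟩) h3 rfl rfl
    | exact exists_minimalPeriod_six_of_cycle hf (.inr ⟨b, c⟩) h3 rfl rfl

theorem HasFold.exists_minimalPeriod_six {f : unitI → unitI} (hf : Continuous f)
    (h : HasFold (f ∘ f)) : ∃ x, minimalPeriod f x = 6 := by
  obtain ⟨a, c, y, hlt, ha, hc, hy⟩ := h
  have hcov := foldInterval_subset_image (hf.comp hf) hlt ha hc hy
  obtain ⟨x, hx, hxR, hxL⟩ := exists_loop (hf.comp hf) (hcov true true) (hcov true false)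
    (hcov false true) (n := 2) two_pos
  have hne : f (f x) ≠ x := fun h => by
    have hL : f (f (f (f x))) ∈ foldInterval a c y false := hxL
    rw [h, h] at hL
    have hxc : x = c := foldInterval_inter_subset hlt ⟨hxR 0 two_pos, hL⟩
    have hcy : c = y := (hxc ▸ h : f (f c) = c).symm.trans hc
    rcases hlt with h | h
    exacts [h.2.ne hcy, h.1.ne' hcy]
  have h6 : IsPeriodicPt f 6 x := hx
  by_cases h3 : f (f (f x)) = x
  · exact exists_minimalPeriod_six_of_three hf h3 fun h => hne (by rw [h, h])
  refine ⟨x, ?_⟩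
  have hdvd : minimalPeriod f x ∣ 6 := h6.minimalPeriod_dvd
  have h2' : ¬ minimalPeriod f x ∣ 2 := fun h => hne ((isPeriodicPt_iff_minimalPeriod_dvd).2 h)
  have h3' : ¬ minimalPeriod f x ∣ 3 := fun h => h3 ((isPeriodicPt_iff_minimalPeriod_dvd).2 h)
  exact eq_six_of_dvd hdvd h2' h3'

/-- If `f ∈ cl(CP)` has positive topological entropy, then `f²` is turbulent,
`h_top(f) ≥ (log 2)/2` and `f` has a periodic point of period `6`.  In particular,
every `f ∈ cl(CP)` satisfies `h_top(f) = 0` or `h_top(f) ≥ (log 2)/2`. -/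
theorem turbulent_of_pos_entropy (f : C(unitI, unitI)) (hf : f ∈ closure CP) :
    (0 < hTop ⇑f →
      Turbulent (⇑f ∘ ⇑f) ∧ ((Real.log 2 / 2 : ℝ) : EReal) ≤ hTop ⇑f ∧
        ∃ x : unitI, Function.minimalPeriod ⇑f x = 6) ∧
    (hTop ⇑f = 0 ∨ ((Real.log 2 / 2 : ℝ) : EReal) ≤ hTop ⇑f) := by
  have hmain : 0 < hTop ⇑f →
      Turbulent (⇑f ∘ ⇑f) ∧ ((Real.log 2 / 2 : ℝ) : EReal) ≤ hTop ⇑f ∧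
        ∃ x : unitI, Function.minimalPeriod ⇑f x = 6 := fun hpos => by
    have hfold : HasFold (f ∘ f) := hasFold_comp_self hf fun hid =>
      (hTop_nonpos_of_comp_self_eq_id f.continuous hid).not_gt hpos
    exact ⟨hfold.turbulent (f.continuous.comp f.continuous),
      hfold.log_two_div_two_le_hTop f.continuous, hfold.exists_minimalPeriod_six f.continuous⟩
  refine ⟨hmain, ?_⟩
  rcases (coverEntropy_nonneg f univ_nonempty : 0 ≤ hTop f).eq_or_lt with h | h
  · exact .inl h.symm
  · exact .inr (hmain h).2.1
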